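/- Let X be a compact metric space, let A₁ and A₂ be closed subalgebras of C(X) containing the constants, let f ∈ C(X), and let u₀ ∈ A₁ + A₂ be a best approximation to f. Suppose {x₁,...,x_n} is a finite bolt extremal for f − u₀ and L = (x₁,...,x_n, y_{n+1},...,y_{n+m}) is a closed bolt obtained from it by adding m further points. Then ((n − m)/(n + m)) ‖f − u₀‖ ≤ |r_L(f)| ≤ ‖f − u₀‖. -/

import Mathlib

open Filter Topology

/-- Two points `a, b` of `X` are linked via the algebra `A ⊆ C(X)` if every
element of `A` takes equal values at `a` and `b`. -/
def AlgLink {X : Type*} [TopologicalSpace X] (A : Subalgebra ℝ C(X, ℝ)) (a b : X) : Prop :=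
  ∀ g : C(X, ℝ), g ∈ A → g a = g b

/-- `x 0, x 1, ..., x (n-1)` is a finite (lightning) bolt with respect to the
algebras `A₁, A₂`: consecutive points are distinct and the consecutive links
alternate between `A₁`-links and `A₂`-links (in one of the two possible orders). -/
def IsFiniteBolt {X : Type*} [TopologicalSpace X] (A₁ A₂ : Subalgebra ℝ C(X, ℝ)) {n : ℕ}
    (x : Fin n → X) : Prop :=
  (∀ (i : ℕ) (h : i + 1 < n), x ⟨i, Nat.lt_of_succ_lt h⟩ ≠ x ⟨i + 1, h⟩) ∧
  ((∀ (i : ℕ) (h : i + 1 < n),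
      if Even i then AlgLink A₁ (x ⟨i, Nat.lt_of_succ_lt h⟩) (x ⟨i + 1, h⟩)
      else AlgLink A₂ (x ⟨i, Nat.lt_of_succ_lt h⟩) (x ⟨i + 1, h⟩)) ∨
   (∀ (i : ℕ) (h : i + 1 < n),
      if Even i then AlgLink A₂ (x ⟨i, Nat.lt_of_succ_lt h⟩) (x ⟨i + 1, h⟩)
      else AlgLink A₁ (x ⟨i, Nat.lt_of_succ_lt h⟩) (x ⟨i + 1, h⟩)))

/-- The cyclically next index in `Fin m`. -/
def nextIdx {m : ℕ} (i : Fin m) : Fin m := ⟨((i : ℕ) + 1) % m, Nat.mod_lt _ i.pos⟩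

/-- `x 0, ..., x (m-1)` is a closed bolt with respect to `A₁, A₂`: the number of
points is even and positive, cyclically consecutive points are distinct, and the
cyclic links alternate between `A₁`-links and `A₂`-links. -/
def IsClosedBolt {X : Type*} [TopologicalSpace X] (A₁ A₂ : Subalgebra ℝ C(X, ℝ)) {m : ℕ}
    (x : Fin m → X) : Prop :=
  0 < m ∧ Even m ∧
  (∀ i : Fin m, x i ≠ x (nextIdx i)) ∧
  ((∀ i : Fin m, if Even (i : ℕ) then AlgLink A₁ (x i) (x (nextIdx i))
      else AlgLink A₂ (x i) (x (nextIdx i))) ∨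
   (∀ i : Fin m, if Even (i : ℕ) then AlgLink A₂ (x i) (x (nextIdx i))
      else AlgLink A₁ (x i) (x (nextIdx i))))

/-- `x 0, x 1, x 2, ...` is an infinite bolt with respect to `A₁, A₂`. -/
def IsInfiniteBolt {X : Type*} [TopologicalSpace X] (A₁ A₂ : Subalgebra ℝ C(X, ℝ))
    (x : ℕ → X) : Prop :=
  (∀ i : ℕ, x i ≠ x (i + 1)) ∧
  ((∀ i : ℕ, if Even i then AlgLink A₁ (x i) (x (i + 1)) else AlgLink A₂ (x i) (x (i + 1))) ∨
   (∀ i : ℕ, if Even i then AlgLink A₂ (x i) (x (i + 1)) else AlgLink A₁ (x i) (x (i + 1))))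

/-- The bolt functional `r_l(F) = (1/n) ∑_{i=1}^n (-1)^{i+1} F(xᵢ)` associated with
the finite bolt `l = {x 0, ..., x (n-1)}` (here indexed from `0`). -/
noncomputable def boltFun {X : Type*} [TopologicalSpace X] {n : ℕ} (x : Fin n → X)
    (F : C(X, ℝ)) : ℝ :=
  (n : ℝ)⁻¹ * ∑ i : Fin n, (-1 : ℝ) ^ (i : ℕ) * F (x i)

/-- The set `A₁ + A₂ = {u₁ + u₂ : u₁ ∈ A₁, u₂ ∈ A₂}`. -/
def algSum {X : Type*} [TopologicalSpace X] (A₁ A₂ : Subalgebra ℝ C(X, ℝ)) : Set C(X, ℝ) :=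
  {u | ∃ u₁ ∈ A₁, ∃ u₂ ∈ A₂, u = u₁ + u₂}

/-- The approximation error `E(f) = inf_{u ∈ A₁+A₂} ‖f - u‖`. -/
noncomputable def approxError {X : Type*} [TopologicalSpace X] [CompactSpace X]
    (A₁ A₂ : Subalgebra ℝ C(X, ℝ)) (f : C(X, ℝ)) : ℝ :=
  ⨅ u : algSum A₁ A₂, ‖f - (u : C(X, ℝ))‖

/-- A finite bolt `x 0, ..., x (n-1)` is extremal for `h ∈ C(X)` if
`h (x i) = (-1)^i ‖h‖` for all `i`, or `h (x i) = (-1)^{i+1} ‖h‖` for all `i`. -/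
def ExtremalFin {X : Type*} [TopologicalSpace X] [CompactSpace X] {n : ℕ}
    (h : C(X, ℝ)) (x : Fin n → X) : Prop :=
  (∀ i : Fin n, h (x i) = (-1 : ℝ) ^ (i : ℕ) * ‖h‖) ∨
  (∀ i : Fin n, h (x i) = (-1 : ℝ) ^ ((i : ℕ) + 1) * ‖h‖)

/-- An infinite bolt `x 0, x 1, ...` is extremal for `h ∈ C(X)` if
`h (x i) = (-1)^i ‖h‖` for all `i`, or `h (x i) = (-1)^{i+1} ‖h‖` for all `i`. -/
def ExtremalSeq {X : Type*} [TopologicalSpace X] [CompactSpace X]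
    (h : C(X, ℝ)) (x : ℕ → X) : Prop :=
  (∀ i : ℕ, h (x i) = (-1 : ℝ) ^ i * ‖h‖) ∨
  (∀ i : ℕ, h (x i) = (-1 : ℝ) ^ (i + 1) * ‖h‖)

theorem nextIdx_bijective {m : ℕ} : Function.Bijective (nextIdx (m := m)) := by
  refine Finite.injective_iff_bijective.mp fun i j h => ?_
  have h' : ((i : ℕ) + 1) % m = ((j : ℕ) + 1) % m := congrArg Fin.val h
  exact Fin.ext (Nat.ModEq.eq_of_lt_of_lt (Nat.ModEq.add_right_cancel' 1 h') i.2 j.2)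

theorem even_nextIdx {m : ℕ} (hm : Even m) (i : Fin m) :
    Even (nextIdx i : ℕ) ↔ ¬ Even (i : ℕ) := by
  have h : ((i : ℕ) + 1) % m % 2 = ((i : ℕ) + 1) % 2 := Nat.mod_mod_of_dvd _ hm.two_dvd
  have h' : (nextIdx i : ℕ) = ((i : ℕ) + 1) % m := rfl
  rw [Nat.even_iff, Nat.even_iff, h', h]
  omega

theorem neg_one_pow_nextIdx {m : ℕ} (hm : Even m) (i : Fin m) :
    (-1 : ℝ) ^ (nextIdx i : ℕ) = -(-1) ^ (i : ℕ) := by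
  by_cases hi : Even (i : ℕ)
  · have h : Odd (nextIdx i : ℕ) := by
      rw [← Nat.not_even_iff_odd, even_nextIdx hm, not_not]
      exact hi
    rw [h.neg_one_pow, hi.neg_one_pow]
  · rw [((even_nextIdx hm i).mpr hi).neg_one_pow, (Nat.not_even_iff_odd.mp hi).neg_one_pow, neg_neg]

/-- An alternating cyclic sum vanishes as soon as its terms agree in the pairs `i, i + 1`
for which `P i` holds, where `P` singles out every second index. -/
theorem alternating_sum_eq_zero {m : ℕ} (hm : Even m) (P : Fin m → Prop)
    (hP : ∀ i, P (nextIdx i) ↔ ¬ P i) (a : Fin m → ℝ) (ha : ∀ i, P i → a i = a (nextIdx i)) :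
    ∑ i : Fin m, (-1 : ℝ) ^ (i : ℕ) * a i = 0 := by
  classical
  have hsplit : ∑ i : Fin m, (-1 : ℝ) ^ (i : ℕ) * a i =
      ∑ i : Fin m, (if P i then (-1 : ℝ) ^ (i : ℕ) * a i else 0) +
        ∑ i : Fin m, (if P i then 0 else (-1 : ℝ) ^ (i : ℕ) * a i) := by
    rw [← Finset.sum_add_distrib]
    refine Finset.sum_congr rfl fun i _ => ?_
    split_ifs <;> simp
  rw [hsplit, ← nextIdx_bijective.sum_comp
    (fun i : Fin m => if P i then 0 else (-1 : ℝ) ^ (i : ℕ) * a i), ← Finset.sum_add_distrib]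
  refine Finset.sum_eq_zero fun i _ => ?_
  by_cases hi : P i
  · simp [hP, hi, neg_one_pow_nextIdx hm, ← ha i hi]
  · simp [hP, hi]

theorem boltFun_sub {X : Type*} [TopologicalSpace X] {n : ℕ} (x : Fin n → X) (F G : C(X, ℝ)) :
    boltFun x (F - G) = boltFun x F - boltFun x G := by
  simp [boltFun, mul_sub, Finset.sum_sub_distrib]

theorem boltFun_add {X : Type*} [TopologicalSpace X] {n : ℕ} (x : Fin n → X) (F G : C(X, ℝ)) :
    boltFun x (F + G) = boltFun x F + boltFun x G := by
  simp [boltFun, mul_add, Finset.sum_add_distrib]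

theorem IsClosedBolt.boltFun_eq_zero {X : Type*} [TopologicalSpace X] {A₁ A₂ : Subalgebra ℝ C(X, ℝ)}
    {m : ℕ} {x : Fin m → X} (hx : IsClosedBolt A₁ A₂ x) {u : C(X, ℝ)} (hu : u ∈ algSum A₁ A₂) :
    boltFun x u = 0 := by
  obtain ⟨-, hm, -, hlink⟩ := hx
  have heven (g : C(X, ℝ)) (h : ∀ i : Fin m, Even (i : ℕ) → g (x i) = g (x (nextIdx i))) :
      boltFun x g = 0 := by
    rw [boltFun, alternating_sum_eq_zero hm (fun i => Even (i : ℕ)) (even_nextIdx hm) _ h, mul_zero]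
  have hodd (g : C(X, ℝ)) (h : ∀ i : Fin m, ¬ Even (i : ℕ) → g (x i) = g (x (nextIdx i))) :
      boltFun x g = 0 := by
    rw [boltFun, alternating_sum_eq_zero hm (fun i => ¬ Even (i : ℕ))
      (fun i => not_congr (even_nextIdx hm i)) _ h, mul_zero]
  obtain ⟨u₁, hu₁, u₂, hu₂, rfl⟩ := hu
  rw [boltFun_add]
  rcases hlink with h | h
  · rw [heven u₁ fun i hi => by have := h i; rw [if_pos hi] at this; exact this u₁ hu₁,
      hodd u₂ fun i hi => by have := h i; rw [if_neg hi] at this; exact this u₂ hu₂, add_zero]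
  · rw [hodd u₁ fun i hi => by have := h i; rw [if_neg hi] at this; exact this u₁ hu₁,
      heven u₂ fun i hi => by have := h i; rw [if_pos hi] at this; exact this u₂ hu₂, add_zero]

theorem abs_sum_neg_one_pow_mul_le {X : Type*} [TopologicalSpace X] [CompactSpace X] {n : ℕ}
    (x : Fin n → X) (e : Fin n → ℕ) (F : C(X, ℝ)) :
    |∑ i, (-1 : ℝ) ^ e i * F (x i)| ≤ n * ‖F‖ := by
  refine (Finset.abs_sum_le_sum_abs _ _).trans ?_
  calc ∑ i, |(-1 : ℝ) ^ e i * F (x i)| ≤ ∑ _i : Fin n, ‖F‖ :=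
        Finset.sum_le_sum fun i _ => by
          rw [abs_mul, abs_neg_one_pow, one_mul]
          exact F.norm_coe_le_norm (x i)
    _ = n * ‖F‖ := by simp

theorem ExtremalFin.abs_sum_eq {X : Type*} [TopologicalSpace X] [CompactSpace X] {n : ℕ}
    {h : C(X, ℝ)} {x : Fin n → X} (hx : ExtremalFin h x) :
    |∑ i : Fin n, (-1 : ℝ) ^ (i : ℕ) * h (x i)| = n * ‖h‖ := by
  rcases hx with hx | hx
  · have hsum : ∑ i : Fin n, (-1 : ℝ) ^ (i : ℕ) * h (x i) = n * ‖h‖ := by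
      simp [hx, ← mul_assoc, ← pow_add, ← two_mul]
    rw [hsum, abs_of_nonneg (by positivity)]
  · have hsum : ∑ i : Fin n, (-1 : ℝ) ^ (i : ℕ) * h (x i) = -(n * ‖h‖) := by
      simp [hx, ← mul_assoc, ← pow_add, pow_succ, ← two_mul]
    rw [hsum, abs_neg, abs_of_nonneg (by positivity)]

theorem closedBolt_completion_bounds {X : Type*} [MetricSpace X] [CompactSpace X]
    (A₁ A₂ : Subalgebra ℝ C(X, ℝ))
    (hA₁ : IsClosed (A₁ : Set C(X, ℝ))) (hA₂ : IsClosed (A₂ : Set C(X, ℝ)))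
    (f : C(X, ℝ)) (u₀ : C(X, ℝ)) (hu₀ : u₀ ∈ algSum A₁ A₂)
    (hbest : ‖f - u₀‖ = approxError A₁ A₂ f)
    {n m : ℕ} (hn : 0 < n) (x : Fin n → X) (hx : IsFiniteBolt A₁ A₂ x)
    (hext : ExtremalFin (f - u₀) x)
    (y : Fin (n + m) → X) (hy : IsClosedBolt A₁ A₂ y)
    (hagree : ∀ i : Fin n, y (Fin.castAdd m i) = x i) :
    ((n : ℝ) - (m : ℝ)) / ((n : ℝ) + (m : ℝ)) * ‖f - u₀‖ ≤ |boltFun y f| ∧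
      |boltFun y f| ≤ ‖f - u₀‖ := by
  have hpos : (0 : ℝ) < (n : ℝ) + m := by positivity
  have hf : boltFun y f = boltFun y (f - u₀) := by
    rw [boltFun_sub, hy.boltFun_eq_zero hu₀, sub_zero]
  have habs : |boltFun y f| =
      |∑ i : Fin (n + m), (-1 : ℝ) ^ (i : ℕ) * (f - u₀) (y i)| / ((n : ℝ) + m) := by
    rw [hf, boltFun, abs_mul, Nat.cast_add, abs_of_pos (inv_pos.mpr hpos), div_eq_inv_mul]
  rw [habs]
  constructor
  · rw [div_mul_eq_mul_div]
    gcongr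
    have hfirst : |∑ i : Fin n, (-1 : ℝ) ^ (i : ℕ) * (f - u₀) (y (Fin.castAdd m i))| =
        n * ‖f - u₀‖ := by
      simp only [hagree]
      exact hext.abs_sum_eq
    have hlast := abs_sum_neg_one_pow_mul_le (fun i : Fin m => y (Fin.natAdd n i))
      (fun i => (Fin.natAdd n i : ℕ)) (f - u₀)
    have htri := abs_sub_abs_le_abs_add
      (∑ i : Fin n, (-1 : ℝ) ^ (i : ℕ) * (f - u₀) (y (Fin.castAdd m i)))
      (∑ i : Fin m, (-1 : ℝ) ^ (Fin.natAdd n i : ℕ) * (f - u₀) (y (Fin.natAdd n i)))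
    rw [Fin.sum_univ_add]
    simp only [Fin.val_castAdd] at *
    linarith
  · rw [div_le_iff₀ hpos, mul_comm]
    exact_mod_cast abs_sum_neg_one_pow_mul_le y (fun i => (i : ℕ)) (f - u₀)
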